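/- At most five equilibrium states for the two-population model: let α ∈ (0,1), J_{11}, J_{22}, h_1, h_2 ∈ ℝ and J_{12} ≠ 0, and define on the open square (−1,1)² the pressure functional p(m_1, m_2) = (1/2)·J_{11}·α²·m_1² + J_{12}·α·(1−α)·m_1·m_2 + (1/2)·J_{22}·(1−α)²·m_2² + α·h_1·m_1 + (1−α)·h_2·m_2 + α·S(m_1) + (1−α)·S(m_2), where S(x) = −((1+x)/2)·ln((1+x)/2) − ((1−x)/2)·ln((1−x)/2). Then the set of points of (−1,1)² at which p has a local maximum contains at most 5 elements. -/

import Mathlib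

noncomputable section

/-- Binary entropy function. -/
def binEnt (x : ℝ) : ℝ :=
  -((1 + x) / 2 * Real.log ((1 + x) / 2)) - (1 - x) / 2 * Real.log ((1 - x) / 2)

/-- The two-population mean field pressure functional on the open square `(−1,1)²`. -/
def twoPopPressure (α J11 J22 J12 h1 h2 : ℝ) (m : ℝ × ℝ) : ℝ :=
  1 / 2 * J11 * α ^ 2 * m.1 ^ 2 + J12 * α * (1 - α) * m.1 * m.2
    + 1 / 2 * J22 * (1 - α) ^ 2 * m.2 ^ 2 + α * h1 * m.1 + (1 - α) * h2 * m.2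
    + α * binEnt m.1 + (1 - α) * binEnt m.2


/-- inverse hyperbolic tangent -/
def atn (x : ℝ) : ℝ := (Real.log (1 + x) - Real.log (1 - x)) / 2

lemma atn_neg (x : ℝ) : atn (-x) = -atn x := by
  unfold atn
  rw [show 1 + -x = 1 - x by ring, show 1 - -x = 1 + x by ring]; ring

lemma one_sub_sq_pos {x : ℝ} (h1 : -1 < x) (h2 : x < 1) : 0 < 1 - x ^ 2 := by nlinarith

lemma hasDerivAt_atn {x : ℝ} (h1 : -1 < x) (h2 : x < 1) :
    HasDerivAt atn (1 / (1 - x ^ 2)) x := by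
  have e1 : HasDerivAt (fun x : ℝ => 1 + x) 1 x := (hasDerivAt_id x).const_add 1
  have e2 : HasDerivAt (fun x : ℝ => 1 - x) (-1) x := (hasDerivAt_id x).const_sub 1
  have h := ((e1.log (by linarith)).sub (e2.log (by linarith))).div_const 2
  refine h.congr_deriv ?_
  have a1 : (1 + x) ≠ 0 := by linarith
  have a2 : (1 - x) ≠ 0 := by linarith
  have a3 : (1 - x ^ 2) ≠ 0 := (one_sub_sq_pos h1 h2).ne'
  field_simp
  ring

lemma atn_chord {x1 x2 : ℝ} (h0 : 0 ≤ x1) (h : x1 < x2) (h1 : x2 < 1) :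
    x2 - x1 < (1 - x1 ^ 2) * (atn x2 - atn x1) := by
  obtain ⟨ξ, ⟨hξ1, hξ2⟩, hξ⟩ := exists_hasDerivAt_eq_slope atn (fun x => 1 / (1 - x ^ 2)) h
    (fun x hx => (hasDerivAt_atn (by linarith [hx.1]) (by linarith [hx.2])).continuousAt.continuousWithinAt)
    (fun x hx => hasDerivAt_atn (by linarith [hx.1]) (by linarith [hx.2]))
  have p1 : 0 < 1 - x1 ^ 2 := one_sub_sq_pos (by linarith) (by linarith)
  have p2 : 0 < 1 - ξ ^ 2 := one_sub_sq_pos (by linarith) (by linarith)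
  have p3 : 1 - ξ ^ 2 < 1 - x1 ^ 2 := by nlinarith
  have hd : 0 < x2 - x1 := by linarith
  have : atn x2 - atn x1 = (x2 - x1) / (1 - ξ ^ 2) := by
    field_simp at hξ ⊢; linarith
  rw [this, ← mul_div_assoc, lt_div_iff₀ p2]
  nlinarith

/-- Stationary points with negative semidefinite Hessian. -/
structure MX (a b c d h k x y : ℝ) : Prop where
  x1 : -1 < x
  x2 : x < 1
  y1 : -1 < y
  y2 : y < 1
  ex : atn x = a * x + b * y + h
  ey : atn y = c * x + d * y + k
  hP : a * (1 - x ^ 2) < 1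
  hQ : d * (1 - y ^ 2) < 1
  hJ : b * c * ((1 - x ^ 2) * (1 - y ^ 2)) ≤ (1 - a * (1 - x ^ 2)) * (1 - d * (1 - y ^ 2))

lemma MX.neg {a b c d h k x y : ℝ} (m : MX a b c d h k x y) :
    MX a b c d (-h) (-k) (-x) (-y) := by
  obtain ⟨x1, x2, y1, y2, ex, ey, hP, hQ, hJ⟩ := m
  refine ⟨by linarith, by linarith, by linarith, by linarith, ?_, ?_, ?_, ?_, ?_⟩
  · rw [atn_neg, ex]; ring
  · rw [atn_neg, ey]; ring
  all_goals simpa using by assumption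

lemma MX.flip {a b c d h k x y : ℝ} (m : MX a b c d h k x y) :
    MX a (-b) (-c) d h (-k) x (-y) := by
  obtain ⟨x1, x2, y1, y2, ex, ey, hP, hQ, hJ⟩ := m
  refine ⟨by linarith, by linarith, by linarith, by linarith, ?_, ?_, ?_, ?_, ?_⟩
  · rw [ex]; ring
  · rw [atn_neg, ey]; ring
  all_goals simpa using by assumption

lemma branch_mono {a x1 x2 : ℝ} (h0 : 0 ≤ x1) (h : x1 < x2) (h1 : x2 < 1)
    (hP : a * (1 - x1 ^ 2) < 1) : atn x1 - a * x1 < atn x2 - a * x2 := by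
  have := atn_chord h0 h h1
  have p1 : 0 < 1 - x1 ^ 2 := one_sub_sq_pos (by linarith) (by linarith)
  have : 0 < (1 - x1 ^ 2) * ((atn x2 - a * x2) - (atn x1 - a * x1)) := by nlinarith
  have := (mul_pos_iff_of_pos_left p1).1 this
  linarith

lemma MX.lt {a b c d h k x y x' y' : ℝ} (hb : 0 < b) (m : MX a b c d h k x y)
    (m' : MX a b c d h k x' y') (h0 : 0 ≤ x) (hx : x < x') : y < y' := by
  have := branch_mono h0 hx m'.x2 m.hP
  have e1 := m.ex
  have e2 := m'.ex
  nlinarith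

lemma MX.y_eq {a b c d h k x y y' : ℝ} (hb : 0 < b) (m : MX a b c d h k x y)
    (m' : MX a b c d h k x y') : y = y' := by
  have e1 := m.ex
  have e2 := m'.ex
  have : b * (y - y') = 0 := by linarith
  rcases mul_eq_zero.1 this with h | h <;> linarith

lemma RR_lt {a b c d h k x y x' y' : ℝ} (hb : 0 < b) (m : MX a b c d h k x y)
    (m' : MX a b c d h k x' y') (h0 : 0 ≤ x) (h1 : 0 ≤ y) (hx : x < x') : False := by
  have hy := m.lt hb m' h0 hx
  have c1 := atn_chord h0 hx m'.x2
  have c2 := atn_chord h1 hy m'.y2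
  rw [m.ex, m'.ex] at c1
  rw [m.ey, m'.ey] at c2
  have hP := m.hP
  have hQ := m.hQ
  have hJ := m.hJ
  set p := 1 - x ^ 2
  set q := 1 - y ^ 2
  have A : (x' - x) * (1 - a * p) < b * (y' - y) * p := by nlinarith
  have B : (y' - y) * (1 - d * q) < c * (x' - x) * q := by nlinarith
  have X : 0 < x' - x := by linarith
  have Y : 0 < y' - y := by linarith
  have := mul_lt_mul'' A B (by apply mul_nonneg <;> linarith) (by apply mul_nonneg <;> linarith)
  have h3 := mul_le_mul_of_nonneg_left hJ (mul_pos X Y).le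
  nlinarith

lemma RR_unique {a b c d h k x y x' y' : ℝ} (hb : 0 < b) (m : MX a b c d h k x y)
    (m' : MX a b c d h k x' y') (h0 : 0 ≤ x) (h1 : 0 ≤ y) (h0' : 0 ≤ x') (h1' : 0 ≤ y') :
    x = x' ∧ y = y' := by
  rcases lt_trichotomy x x' with h | h | h
  · exact (RR_lt hb m m' h0 h1 h).elim
  · subst h; exact ⟨rfl, m.y_eq hb m'⟩
  · exact (RR_lt hb m' m h0' h1' h).elim

lemma LL_unique {a b c d h k x y x' y' : ℝ} (hb : 0 < b) (m : MX a b c d h k x y)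
    (m' : MX a b c d h k x' y') (h0 : x ≤ 0) (h1 : y ≤ 0) (h0' : x' ≤ 0) (h1' : y' ≤ 0) :
    x = x' ∧ y = y' := by
  have := RR_unique hb m.neg m'.neg (by linarith) (by linarith) (by linarith) (by linarith)
  constructor <;> linarith

lemma lt_atn {x : ℝ} (h0 : 0 < x) (h1 : x < 1) : x < atn x := by
  have := atn_chord le_rfl h0 h1
  simpa [atn] using this

lemma both {a b c d h k x y x' y' : ℝ} (hb : 0 < b) (hc : 0 < c) (m : MX a b c d h k x y)
    (m' : MX a b c d h k x' y') (h0 : 0 < x) (h1 : y < 0) (h0' : x' < 0) (h1' : 0 < y') :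
    1 < a ∧ 1 < d ∧ b * c < (a - 1) * (d - 1) := by
  have t1 := lt_atn h0 m.x2
  have t2 := lt_atn (neg_pos.2 h0') m'.neg.x2
  have t3 := lt_atn (neg_pos.2 h1) m.neg.y2
  have t4 := lt_atn h1' m'.y2
  rw [atn_neg] at t2 t3
  rw [m.ex] at t1
  rw [m.ey] at t3
  rw [m'.ex] at t2
  rw [m'.ey] at t4
  have X : 0 < x - x' := by linarith
  have Y : 0 < y' - y := by linarith
  have A : b * (y' - y) < (a - 1) * (x - x') := by nlinarith
  have B : c * (x - x') < (d - 1) * (y' - y) := by nlinarith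
  have a1 : 0 < a - 1 := by
    have := (mul_pos hb Y).trans A
    exact (pos_iff_pos_of_mul_pos this).2 X
  have d1 : 0 < d - 1 := by
    have := (mul_pos hc X).trans B
    exact (pos_iff_pos_of_mul_pos this).2 Y
  refine ⟨by linarith, by linarith, ?_⟩
  have := mul_lt_mul'' A B (by positivity) (by positivity)
  have XY := mul_pos X Y
  by_contra hcon
  have := mul_le_mul_of_nonneg_left (not_lt.1 hcon) XY.le
  nlinarith

lemma trapz {x1 x2 : ℝ} (h0 : 0 < x1) (h : x1 < x2) (h1 : x2 < 1) :
    x2 - x1 ≤ ((1 / x1 ^ 2 + 1 / x2 ^ 2) / 2 - 1) * ((atn x2 - atn x1) - (x2 - x1)) := by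
  have inv1 : ∀ x : ℝ, 0 < x → x < 1 → 1 < 1 / x ^ 2 := by
    intro x hx hx1
    rw [lt_div_iff₀ (by positivity)]; nlinarith
  have Mpos : ∀ x : ℝ, 0 < x → x < 1 → 0 < (1 / x1 ^ 2 + 1 / x ^ 2) / 2 - 1 := by
    intro x hx hx1
    have := inv1 x hx hx1
    have := inv1 x1 h0 (by linarith)
    linarith
  have hder : ∀ x : ℝ, 0 < x → x < 1 → HasDerivAt
      (fun x => atn x - x - (x - x1) / ((1 / x1 ^ 2 + 1 / x ^ 2) / 2 - 1))
      (1 / (1 - x ^ 2) - 1 - (1 * ((1 / x1 ^ 2 + 1 / x ^ 2) / 2 - 1) - (x - x1) * (-(1 / x ^ 3))) /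
        ((1 / x1 ^ 2 + 1 / x ^ 2) / 2 - 1) ^ 2) x := by
    intro x hx hx1
    have d2 : HasDerivAt (fun x : ℝ => (1 / x1 ^ 2 + 1 / x ^ 2) / 2 - 1) (-(1 / x ^ 3)) x := by
      have d0 : HasDerivAt (fun t : ℝ => t ^ 2) (2 * x) x := by simpa using hasDerivAt_pow 2 x
      have := (((d0.fun_inv (by positivity)).const_add (1 / x1 ^ 2)).div_const 2).sub_const 1
      simp only [← one_div] at this
      refine this.congr_deriv ?_
      field_simp
    exact ((hasDerivAt_atn (by linarith) hx1).sub (hasDerivAt_id x)).sub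
      (((hasDerivAt_id x).sub_const x1).div d2 (Mpos x hx hx1).ne')
  have mono : MonotoneOn (fun x => atn x - x - (x - x1) / ((1 / x1 ^ 2 + 1 / x ^ 2) / 2 - 1))
      (Set.Icc x1 x2) := by
    refine monotoneOn_of_hasDerivWithinAt_nonneg (convex_Icc _ _)
      (fun x hx => (hder x (by linarith [hx.1]) (by linarith [hx.2])).continuousAt.continuousWithinAt)
      (f' := fun x => (1 / (1 - x ^ 2) - 1 - (1 * ((1 / x1 ^ 2 + 1 / x ^ 2) / 2 - 1) - (x - x1) * (-(1 / x ^ 3))) /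
        ((1 / x1 ^ 2 + 1 / x ^ 2) / 2 - 1) ^ 2)) ?_ ?_
    · intro x hx
      rw [interior_Icc] at hx
      exact (hder x (by linarith [hx.1]) (by linarith [hx.2])).hasDerivWithinAt
    · intro x hx
      rw [interior_Icc] at hx
      have hx0 : 0 < x := by linarith [hx.1]
      have hx1 : x < 1 := by linarith [hx.2]
      have M0 := Mpos x hx0 hx1
      have hlt := hx.1
      have hp : 0 < 1 - x ^ 2 := one_sub_sq_pos (by linarith) hx1
      have e1 : (1 / x1 ^ 2 + 1 / x ^ 2) / 2 - 1 = (1 / x ^ 2 - 1) + (x ^ 2 - x1 ^ 2) / (2 * x ^ 2 * x1 ^ 2) := by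
        field_simp; ring
      set M := (1 / x1 ^ 2 + 1 / x ^ 2) / 2 - 1 with hM
      clear_value M
      have hMge : (1 - x ^ 2) / x ^ 2 ≤ M := by
        rw [e1]
        have : 0 ≤ (x ^ 2 - x1 ^ 2) / (2 * x ^ 2 * x1 ^ 2) := by
          apply div_nonneg _ (by positivity); nlinarith
        have : (1 - x ^ 2) / x ^ 2 = 1 / x ^ 2 - 1 := by field_simp
        linarith
      have key : M * (x * (x + x1)) ≥ 2 * ((1 - x ^ 2) / x ^ 2) * x1 ^ 2 := by
        have : 2 * x1 ^ 2 ≤ x * (x + x1) := by nlinarith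
        have h5 : 0 < (1 - x ^ 2) / x ^ 2 := by positivity
        nlinarith
      have e2 : M * (2 * x ^ 2 * x1 ^ 2) = (1 - x ^ 2) * (2 * x1 ^ 2) + (x ^ 2 - x1 ^ 2) := by
        rw [e1]; field_simp
      have e3 : 1 / (1 - x ^ 2) - 1 - (1 * M - (x - x1) * (-(1 / x ^ 3))) / M ^ 2
          = (x - x1) * (M * (x * (x + x1)) - 2 * ((1 - x ^ 2) / x ^ 2) * x1 ^ 2) /
            (2 * x1 ^ 2 * x * (1 - x ^ 2) * M ^ 2) := by
        field_simp
        linear_combination (x ^ 3 * M) * e2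
      rw [e3]
      apply div_nonneg
      · apply mul_nonneg <;> linarith
      · positivity
  have := mono (Set.left_mem_Icc.2 h.le) (Set.right_mem_Icc.2 h.le) h.le
  simp only [sub_self, zero_div] at this
  have M0 := Mpos x2 (by linarith) h1
  have : (x2 - x1) / ((1 / x1 ^ 2 + 1 / x2 ^ 2) / 2 - 1) ≤ (atn x2 - atn x1) - (x2 - x1) := by linarith
  rw [div_le_iff₀ M0] at this
  linarith

lemma RL_lt {a b c d h k x y x' y' : ℝ} (hb : 0 < b) (hc : 0 < c)
    (hdet : b * c < (a - 1) * (d - 1)) (m : MX a b c d h k x y)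
    (m' : MX a b c d h k x' y') (h0 : 0 < x) (h1 : y' < 0) (hx : x < x') : False := by
  have hy := m.lt hb m' h0.le hx
  have t1 := trapz h0 hx m'.x2
  have t2 := trapz (neg_pos.2 h1) (neg_lt_neg hy) (by linarith [m.y1])
  simp only [atn_neg, neg_sq] at t2
  have hx' : 0 < x' := by linarith
  have hyy : y < 0 := by linarith
  have hyn := hyy.ne
  have hyn' := h1.ne
  have key : ∀ x y : ℝ, x ≠ 0 → y ≠ 0 → MX a b c d h k x y →
      (a - 1) * (1 / x ^ 2 - 1) < 1 ∧ (d - 1) * (1 / y ^ 2 - 1) < 1 ∧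
      b * c * ((1 / x ^ 2 - 1) * (1 / y ^ 2 - 1)) ≤
        (1 - (a - 1) * (1 / x ^ 2 - 1)) * (1 - (d - 1) * (1 / y ^ 2 - 1)) := by
    intro x y hx0 hy0 m
    have sx : 0 < x ^ 2 := by positivity
    have sy : 0 < y ^ 2 := by positivity
    refine ⟨?_, ?_, ?_⟩
    · have := m.hP
      rw [show (a - 1) * (1 / x ^ 2 - 1) = ((a - 1) * (1 - x ^ 2)) / x ^ 2 by field_simp, div_lt_one sx]
      linarith
    · have := m.hQ
      rw [show (d - 1) * (1 / y ^ 2 - 1) = ((d - 1) * (1 - y ^ 2)) / y ^ 2 by field_simp, div_lt_one sy]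
      linarith
    · have hJ := m.hJ
      have e1 : b * c * ((1 / x ^ 2 - 1) * (1 / y ^ 2 - 1)) =
        b * c * ((1 - x ^ 2) * (1 - y ^ 2)) / (x ^ 2 * y ^ 2) := by field_simp
      have e2 : (1 - (a - 1) * (1 / x ^ 2 - 1)) * (1 - (d - 1) * (1 / y ^ 2 - 1)) =
        (1 - a * (1 - x ^ 2)) * (1 - d * (1 - y ^ 2)) / (x ^ 2 * y ^ 2) := by field_simp; ring
      rw [e1, e2]
      gcongr
  obtain ⟨k1, k2, k3⟩ := key x y h0.ne' hyy.ne m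
  obtain ⟨l1, l2, l3⟩ := key x' y' hx'.ne' h1.ne m'
  have g1 : 1 / x' ^ 2 < 1 / x ^ 2 := by
    apply one_div_lt_one_div_of_lt (by positivity); nlinarith
  have g2 : 1 / y ^ 2 < 1 / y' ^ 2 := by
    apply one_div_lt_one_div_of_lt (by positivity); nlinarith
  have g3 : 0 < 1 / x' ^ 2 - 1 := by
    have : 1 < 1 / x' ^ 2 := by rw [lt_div_iff₀ (by positivity)]; nlinarith [m'.x2]
    linarith
  have g4 : 0 < 1 / y ^ 2 - 1 := by
    have : 1 < 1 / y ^ 2 := by rw [lt_div_iff₀ (by positivity)]; nlinarith [m.y1]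
    linarith
  have ex1 := m.ex
  have ex2 := m'.ex
  have ey1 := m.ey
  have ey2 := m'.ey
  set P := 1 / x ^ 2
  set P' := 1 / x' ^ 2
  set Q := 1 / y ^ 2
  set Q' := 1 / y' ^ 2
  rw [ex1, ex2] at t1
  rw [ey1, ey2] at t2
  obtain ⟨M, hM⟩ : ∃ M, M = (P + P') / 2 - 1 := ⟨_, rfl⟩
  obtain ⟨N, hN⟩ : ∃ N, N = (Q' + Q) / 2 - 1 := ⟨_, rfl⟩
  rw [← hM] at t1
  rw [← hN] at t2
  have X : 0 < x' - x := by linarith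
  have Y : 0 < y' - y := by linarith
  have M0 : 0 < M := by linarith
  have N0 : 0 < N := by linarith
  have A0 : 0 < 1 - (a - 1) * M := by rw [hM]; linarith
  have B0 : 0 < 1 - (d - 1) * N := by rw [hN]; linarith
  have A : (x' - x) * (1 - (a - 1) * M) ≤ b * M * (y' - y) := by linarith
  have B : (y' - y) * (1 - (d - 1) * N) ≤ c * N * (x' - x) := by linarith
  have C := mul_le_mul A B (by positivity) (by positivity)
  have D : (1 - (a - 1) * M) * (1 - (d - 1) * N) ≤ b * c * (M * N) := by
    by_contra hcon
    have := mul_lt_mul_of_pos_left (not_le.1 hcon) (mul_pos X Y)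
    linarith
  have E : 0 < ((a - 1) * (d - 1) - b * c) * ((P - P') * (Q' - Q)) := by
    apply mul_pos (by linarith)
    apply mul_pos <;> linarith
  rw [hM, hN] at D
  linarith

lemma RL_unique {a b c d h k x y x' y' : ℝ} (hb : 0 < b) (hc : 0 < c)
    (hdet : b * c < (a - 1) * (d - 1)) (m : MX a b c d h k x y)
    (m' : MX a b c d h k x' y') (h0 : 0 < x) (h1 : y < 0) (h0' : 0 < x') (h1' : y' < 0) :
    x = x' ∧ y = y' := by
  rcases lt_trichotomy x x' with h | h | h
  · exact (RL_lt hb hc hdet m m' h0 h1' h).elim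
  · subst h; exact ⟨rfl, m.y_eq hb m'⟩
  · exact (RL_lt hb hc hdet m' m h0' h1 h).elim

lemma LR_unique {a b c d h k x y x' y' : ℝ} (hb : 0 < b) (hc : 0 < c)
    (hdet : b * c < (a - 1) * (d - 1)) (m : MX a b c d h k x y)
    (m' : MX a b c d h k x' y') (h0 : x < 0) (h1 : 0 < y) (h0' : x' < 0) (h1' : 0 < y') :
    x = x' ∧ y = y' := by
  have := RL_unique hb hc hdet m.neg m'.neg (by linarith) (by linarith) (by linarith) (by linarith)
  constructor <;> linarith

lemma rolle_fin {n : ℕ} (f f' : ℝ → ℝ) (C lo hi : ℝ) (z : Fin (n + 1) → ℝ) (hz : StrictMono z)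
    (hr : ∀ i, z i ∈ Set.Icc lo hi) (hf : ∀ i, f (z i) = C)
    (hd : ∀ x ∈ Set.Icc lo hi, HasDerivAt f (f' x) x) :
    ∃ w : Fin n → ℝ, StrictMono w ∧ (∀ i, w i ∈ Set.Icc lo hi) ∧ ∀ i, f' (w i) = 0 := by
  have key : ∀ i : Fin n, ∃ w, w ∈ Set.Ioo (z i.castSucc) (z i.succ) ∧ f' w = 0 := by
    intro i
    have hlt : z i.castSucc < z i.succ := hz i.castSucc_lt_succ
    have hmem : ∀ x ∈ Set.Icc (z i.castSucc) (z i.succ), x ∈ Set.Icc lo hi := fun x hx =>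
      ⟨(hr _).1.trans hx.1, hx.2.trans (hr _).2⟩
    obtain ⟨w, hw, hw'⟩ := exists_hasDerivAt_eq_zero (f := f) (f' := f') hlt
      (fun x hx => (hd x (hmem x hx)).continuousAt.continuousWithinAt)
      (by rw [hf, hf]) (fun x hx => hd x (hmem x ⟨hx.1.le, hx.2.le⟩))
    exact ⟨w, hw, hw'⟩
  choose w hw hw' using key
  refine ⟨w, ?_, ?_, hw'⟩
  · intro i j hij
    have h1 := (hw i).2
    have h2 := (hw j).1
    have : z i.succ ≤ z j.castSucc := hz.monotone (by
      rw [Fin.le_def]; simp; exact hij)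
    linarith
  · intro i
    exact ⟨(hr _).1.trans (hw i).1.le, (hw i).2.le.trans (hr _).2⟩

lemma lin_pos {A B p1 p2 p : ℝ} (h1 : 0 < A + B * p1) (h2 : 0 < A + B * p2) (l : p1 ≤ p) (r : p ≤ p2) :
    0 < A + B * p := by
  rcases le_total 0 B with h | h <;> nlinarith

lemma quartic_no_roots (c0 c1 c2 c3 c4 : ℝ) (hne : ¬ (c0 = 0 ∧ c1 = 0)) (p : Fin 5 → ℝ)
    (hp : Function.Injective p)
    (h0 : ∀ i, c0 + c1 * p i + c2 * p i ^ 2 + c3 * p i ^ 3 + c4 * p i ^ 4 = 0) : False := by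
  open Polynomial in
  have hz : (C c4 * X ^ 4 + C c3 * X ^ 3 + C c2 * X ^ 2 + C c1 * X + C c0 : ℝ[X]) = 0 := by
    refine Polynomial.eq_zero_of_natDegree_lt_card_of_eval_eq_zero _ hp ?_ ?_
    · intro i
      simp
      linarith [h0 i]
    · simp
      refine lt_of_le_of_lt (b := 4) ?_ (by norm_num)
      compute_degree
  apply hne
  constructor
  · have := congrArg (fun q => Polynomial.coeff q 0) hz
    simpa using this
  · have := congrArg (fun q => Polynomial.coeff q 1) hz
    simpa [Polynomial.coeff_X, Polynomial.coeff_C] using this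

lemma core (a b d h β : ℝ) (hβ : 0 < β) (z y : Fin 7 → ℝ) (hz : StrictMono z)
    (z0 : ∀ i, 0 < z i) (z1 : ∀ i, z i < 1) (y0 : ∀ i, y i < 0) (y1 : ∀ i, -1 < y i)
    (hE : ∀ i, atn (z i) = a * z i + b * y i + h) (hP : ∀ i, a * (1 - z i ^ 2) < 1)
    (hJ : ∀ i, (1 - a * (1 - z i ^ 2)) * (1 - d * (1 - y i ^ 2)) =
      β * ((1 - z i ^ 2) * (1 - y i ^ 2))) : False := by
  obtain ⟨δ, hδ⟩ : ∃ δ, δ = a * d - β := ⟨_, rfl⟩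
  have q0 : ∀ i, 0 < 1 - y i ^ 2 := fun i => one_sub_sq_pos (y1 i) (by linarith [y0 i])
  have p0 : ∀ i, 0 < 1 - z i ^ 2 := fun i => one_sub_sq_pos (by linarith [z0 i]) (z1 i)
  have eqn : ∀ i, (1 - y i ^ 2) * (d - δ * (1 - z i ^ 2)) = 1 - a * (1 - z i ^ 2) := by
    intro i; rw [hδ]; linarith [hJ i]
  have L2z : ∀ i, 0 < d - δ * (1 - z i ^ 2) := by
    intro i
    have : 0 < (1 - y i ^ 2) * (d - δ * (1 - z i ^ 2)) := by rw [eqn]; linarith [hP i]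
    exact (mul_pos_iff_of_pos_left (q0 i)).1 this
  have L1z' : ∀ i, d - 1 + (a - δ) * (1 - z i ^ 2) = y i ^ 2 * (d - δ * (1 - z i ^ 2)) := by
    intro i; linarith [eqn i]
  have L1z : ∀ i, 0 < d - 1 + (a - δ) * (1 - z i ^ 2) := by
    intro i; rw [L1z']
    have := y0 i
    have := L2z i
    have : 0 < y i ^ 2 := by nlinarith
    positivity
  set lo := z 0 with hlo
  set hi := z (Fin.last 6) with hhi
  have hr : ∀ i, z i ∈ Set.Icc lo hi := fun i => ⟨hz.monotone (Fin.zero_le i), hz.monotone (Fin.le_last i)⟩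
  have x0 : ∀ x ∈ Set.Icc lo hi, 0 < x := fun x hx => (z0 0).trans_le hx.1
  have x1 : ∀ x ∈ Set.Icc lo hi, x < 1 := fun x hx => hx.2.trans_lt (z1 _)
  have pl : ∀ x ∈ Set.Icc lo hi, 1 - hi ^ 2 ≤ 1 - x ^ 2 := fun x hx => by
    have := x0 x hx; have := hx.2; nlinarith
  have pu : ∀ x ∈ Set.Icc lo hi, 1 - x ^ 2 ≤ 1 - lo ^ 2 := fun x hx => by
    have := z0 0; have := hx.1; nlinarith
  have pp : ∀ x ∈ Set.Icc lo hi, 0 < 1 - x ^ 2 := fun x hx =>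
    one_sub_sq_pos (by linarith [x0 x hx]) (x1 x hx)
  have L1 : ∀ x ∈ Set.Icc lo hi, 0 < d - 1 + (a - δ) * (1 - x ^ 2) := fun x hx =>
    lin_pos (L1z (Fin.last 6)) (L1z 0) (pl x hx) (pu x hx)
  have L2 : ∀ x ∈ Set.Icc lo hi, 0 < d - δ * (1 - x ^ 2) := fun x hx => by
    have := lin_pos (A := d) (B := -δ) (by linarith [L2z (Fin.last 6)]) (by linarith [L2z 0]) (pl x hx) (pu x hx)
    linarith
  have L3 : ∀ x ∈ Set.Icc lo hi, 0 < 1 - a * (1 - x ^ 2) := fun x hx => by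
    have := lin_pos (A := 1) (B := -a) (by linarith [hP (Fin.last 6)]) (by linarith [hP 0]) (pl x hx) (pu x hx)
    linarith
  have dp : ∀ x : ℝ, HasDerivAt (fun x : ℝ => 1 - x ^ 2) (-(2 * x)) x := fun x => by
    simpa using ((hasDerivAt_id x).pow 2).const_sub 1
  have dl : ∀ A B x : ℝ, HasDerivAt (fun x : ℝ => A + B * (1 - x ^ 2)) (B * (-(2 * x))) x := fun A B x =>
    ((dp x).const_mul B).const_add A
  obtain ⟨w, hw, hwr, hw0⟩ := rolle_fin
    (fun x => atn x - a * x + b * √((d - 1 + (a - δ) * (1 - x ^ 2)) / (d + (-δ) * (1 - x ^ 2))))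
    (fun x => 1 / (1 - x ^ 2) - a * 1 + b * (((((a - δ) * (-(2 * x))) * (d + (-δ) * (1 - x ^ 2)) -
        (d - 1 + (a - δ) * (1 - x ^ 2)) * ((-δ) * (-(2 * x)))) / (d + (-δ) * (1 - x ^ 2)) ^ 2) /
        (2 * √((d - 1 + (a - δ) * (1 - x ^ 2)) / (d + (-δ) * (1 - x ^ 2))))))
    h lo hi z hz hr
    (by
      intro i
      have : (d - 1 + (a - δ) * (1 - z i ^ 2)) / (d + (-δ) * (1 - z i ^ 2)) = (-y i) ^ 2 := by
        have h2 := L2z i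
        rw [L1z', show d + (-δ) * (1 - z i ^ 2) = d - δ * (1 - z i ^ 2) by ring]
        field_simp
      simp only [this]
      rw [Real.sqrt_sq (by linarith [y0 i])]
      linarith [hE i])
    (by
      intro x hx
      have h2 : 0 < d + (-δ) * (1 - x ^ 2) := by linarith [L2 x hx]
      exact ((hasDerivAt_atn (by linarith [x0 x hx]) (x1 x hx)).sub ((hasDerivAt_id x).const_mul a)).add
        ((((dl (d - 1) (a - δ) x).div (dl d (-δ) x) h2.ne').sqrt (div_pos (L1 x hx) h2).ne').const_mul b))
  have alg : ∀ i, (d - 1 + (a - δ) * (1 - w i ^ 2)) * (d - δ * (1 - w i ^ 2)) ^ 3 *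
      (1 - a * (1 - w i ^ 2)) ^ 2 / ((1 - w i ^ 2) ^ 2 * (1 - (1 - w i ^ 2))) = (b * β) ^ 2 := by
    intro i
    have e := hw0 i
    have l1 := L1 _ (hwr i)
    have l2 := L2 _ (hwr i)
    have l3 := L3 _ (hwr i)
    have l4 := pp _ (hwr i)
    have l5 := x0 _ (hwr i)
    simp only [neg_mul, ← sub_eq_add_neg] at e
    generalize w i = x at *
    set p := 1 - x ^ 2 with hp
    have hu : 0 < √((d - 1 + (a - δ) * p) / (d - δ * p)) := Real.sqrt_pos.2 (div_pos l1 l2)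
    have hu2 : √((d - 1 + (a - δ) * p) / (d - δ * p)) ^ 2 = (d - 1 + (a - δ) * p) / (d - δ * p) :=
      Real.sq_sqrt (div_pos l1 l2).le
    generalize √((d - 1 + (a - δ) * p) / (d - δ * p)) = u at *
    have e' : (1 - a * p) * (d - δ * p) ^ 2 * u = b * β * x * p := by
      rw [show (a - δ) * -(2 * x) * (d - δ * p) - (d - 1 + (a - δ) * p) * -(δ * -(2 * x)) = -(2 * x * β) by
        rw [hδ]; ring] at e
      generalize d - δ * p = G at *
      field_simp at e
      linear_combination e
    rw [eq_div_iff l2.ne'] at hu2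
    rw [← hu2, div_eq_iff (by rw [hp]; have := hp ▸ l4.ne'; simp; exact ⟨this, l5.ne'⟩)]
    have e2 : ((1 - a * p) * (d - δ * p) ^ 2 * u) ^ 2 = (b * β * x * p) ^ 2 := by rw [e']
    rw [show 1 - p = x ^ 2 by rw [hp]; ring]
    linear_combination e2
  obtain ⟨v, hv, hvr, hv0⟩ := rolle_fin
    (fun x => (d - 1 + (a - δ) * (1 - x ^ 2)) * (d + (-δ) * (1 - x ^ 2)) ^ 3 *
      (1 + (-a) * (1 - x ^ 2)) ^ 2 / ((1 - x ^ 2) ^ 2 * (1 + (-1) * (1 - x ^ 2))))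
    (fun x => (((((a - δ) * (-(2 * x))) * (d + (-δ) * (1 - x ^ 2)) ^ 3 + (d - 1 + (a - δ) * (1 - x ^ 2)) *
          ((3 : ℕ) * (d + (-δ) * (1 - x ^ 2)) ^ (3 - 1) * ((-δ) * (-(2 * x))))) * (1 + (-a) * (1 - x ^ 2)) ^ 2 +
          (d - 1 + (a - δ) * (1 - x ^ 2)) * (d + (-δ) * (1 - x ^ 2)) ^ 3 *
          ((2 : ℕ) * (1 + (-a) * (1 - x ^ 2)) ^ (2 - 1) * ((-a) * (-(2 * x))))) *
          ((1 - x ^ 2) ^ 2 * (1 + (-1) * (1 - x ^ 2))) -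
          ((d - 1 + (a - δ) * (1 - x ^ 2)) * (d + (-δ) * (1 - x ^ 2)) ^ 3 *
          (1 + (-a) * (1 - x ^ 2)) ^ 2) * (((2 : ℕ) * (1 - x ^ 2) ^ (2 - 1) * (-(2 * x))) *
            (1 + (-1) * (1 - x ^ 2)) + (1 - x ^ 2) ^ 2 * ((-1) * (-(2 * x))))) /
          ((1 - x ^ 2) ^ 2 * (1 + (-1) * (1 - x ^ 2))) ^ 2)
    ((b * β) ^ 2) lo hi w hw hwr
    (by
      intro i
      simp only [neg_mul, ← sub_eq_add_neg, one_mul]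
      exact alg i)
    (by
      intro x hx
      have h4 := pp x hx
      have h5 := x0 x hx
      exact (((dl (d - 1) (a - δ) x).mul ((dl d (-δ) x).pow 3)).mul ((dl 1 (-a) x).pow 2)).div
        (((dp x).pow 2).mul (dl 1 (-1) x)) (by
          have : 0 < 1 + -1 * (1 - x ^ 2) := by nlinarith
          positivity))
  have quart : ∀ i, (fun p : ℝ => (a - δ) * (d - δ * p) * (1 - a * p) * (p * (1 - p))
      - 3 * δ * (d - 1 + (a - δ) * p) * (1 - a * p) * (p * (1 - p))
      - 2 * a * (d - 1 + (a - δ) * p) * (d - δ * p) * (p * (1 - p))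
      - 2 * (d - 1 + (a - δ) * p) * (d - δ * p) * (1 - a * p) * (1 - p)
      + (d - 1 + (a - δ) * p) * (d - δ * p) * (1 - a * p) * p) (1 - v i ^ 2) = 0 := by
    intro i
    have e := hv0 i
    have l2 := L2 _ (hvr i)
    have l3 := L3 _ (hvr i)
    have l4 := pp _ (hvr i)
    have l5 := x0 _ (hvr i)
    simp only [neg_mul, ← sub_eq_add_neg, one_mul] at e
    beta_reduce
    generalize v i = x at *
    have l6 : 0 < 1 - (1 - x ^ 2) := by nlinarith
    set p := 1 - x ^ 2 with hp
    rw [div_eq_zero_iff] at e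
    rcases e with e | e
    · have hne : (-(2 * x)) * ((d - δ * p) ^ 2 * (1 - a * p) * p) ≠ 0 := by
        apply mul_ne_zero
        · intro h; linarith
        · positivity
      apply (mul_eq_zero.1 _).resolve_left hne
      rw [← e]
      push_cast
      ring
    · exfalso
      have : 0 < (p ^ 2 * (1 - p)) ^ 2 := by positivity
      linarith
  have inj : Function.Injective (fun i => 1 - v i ^ 2) := by
    intro i j hij
    have h1 := x0 _ (hvr i)
    have h2 := x0 _ (hvr j)
    apply hv.injective
    have : v i ^ 2 = v j ^ 2 := by simp at hij; linarith
    exact (pow_left_inj₀ h1.le h2.le two_ne_zero).1 this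
  refine quartic_no_roots
    ((-2) * d ^ 2 + (2) * d ^ 1)
    ((-1) * a ^ 1 * d ^ 1 + (1) * δ ^ 1 + (3) * d ^ 2 + (-3) * d ^ 1)
    ((3) * a ^ 1 * d ^ 1 + (-1) * a ^ 2 * d ^ 1 + (-5) * a ^ 1 * δ ^ 1 + (-2) * d ^ 1 * δ ^ 1 + (4) * a ^ 1 * d ^ 1 * δ ^ 1 + (2) * δ ^ 2 + (-1) * a ^ 1 * d ^ 2)
    ((3) * a ^ 1 * δ ^ 1 + (4) * a ^ 2 * δ ^ 1 + (-2) * a ^ 1 * d ^ 1 * δ ^ 1 + (-1) * δ ^ 2 + (-4) * a ^ 1 * δ ^ 2)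
    ((-3) * a ^ 2 * δ ^ 1 + (3) * a ^ 1 * δ ^ 2)
    ?_ (fun i => 1 - v i ^ 2) inj (fun i => ?_)
  · rintro ⟨k0, k1⟩
    have k0' : d * (d - 1) = 0 := by linarith
    rcases mul_eq_zero.1 k0' with hd0 | hd1
    · rw [hd0] at k1 hδ
      have : δ = 0 := by linarith
      linarith
    · have hd1' : d = 1 := by linarith
      rw [hd1'] at k1 hδ
      have : a - δ = 0 := by linarith
      linarith
  · have := quart i
    beta_reduce at this
    linear_combination this

/-- the curve of the first mean field equation -/
def fE (a b h x : ℝ) : ℝ := (atn x - a * x - h) / b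

lemma MX.fE_eq {a b c d h k x y : ℝ} (hb : 0 < b) (m : MX a b c d h k x y) : fE a b h x = y := by
  unfold fE
  rw [m.ex]; field_simp; ring

lemma fE_lt {a b h x1 x2 : ℝ} (hb : 0 < b) (h0 : 0 ≤ x1) (h12 : x1 < x2) (h1 : x2 < 1)
    (hP : a * (1 - x1 ^ 2) < 1) : fE a b h x1 < fE a b h x2 := by
  unfold fE
  have := branch_mono h0 h12 h1 hP
  gcongr

lemma hasDerivAt_fE {a b h x : ℝ} (h1 : -1 < x) (h2 : x < 1) :
    HasDerivAt (fE a b h) ((1 / (1 - x ^ 2) - a * 1) / b) x :=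
  (((hasDerivAt_atn h1 h2).sub ((hasDerivAt_id x).const_mul a)).sub_const h).div_const b

/-- The Jacobian along the curve with level `β`. -/
def Jac (a b d h β x : ℝ) : ℝ :=
  (1 - a * (1 - x ^ 2)) * (1 - d * (1 - fE a b h x ^ 2)) - β * ((1 - x ^ 2) * (1 - fE a b h x ^ 2))

lemma bad_or {a b c d h k x1 x2 : ℝ} (hb : 0 < b) (h0 : 0 < x1) (h12 : x1 < x2)
    (m1 : MX a b c d h k x1 (fE a b h x1)) (m2 : MX a b c d h k x2 (fE a b h x2)) :
    (∃ w ∈ Set.Ioo x1 x2, Jac a b d h (b * c) w < 0) ∨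
      ∀ w ∈ Set.Ioo x1 x2, Jac a b d h (b * c) w = 0 := by
  by_cases hbad : ∃ w ∈ Set.Ioo x1 x2, Jac a b d h (b * c) w < 0
  · exact Or.inl hbad
  right
  push Not at hbad
  have hx : ∀ x ∈ Set.Icc x1 x2, -1 < x ∧ x < 1 ∧ -1 < fE a b h x ∧ fE a b h x < 1 := by
    intro x hx
    refine ⟨by linarith [hx.1], by linarith [hx.2, m2.x2], ?_, ?_⟩
    · rcases hx.1.eq_or_lt with e | e
      · rw [← e]; exact m1.y1
      · exact m1.y1.trans (fE_lt hb h0.le e (by linarith [hx.2, m2.x2]) m1.hP)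
    · rcases hx.2.eq_or_lt with e | e
      · rw [e]; exact m2.y2
      · refine (fE_lt hb (by linarith [hx.1]) e m2.x2 ?_).trans m2.y2
        rcases le_total 0 a with ha | ha
        · have := hx.1
          have h5 := m1.hP
          have : x1 ^ 2 ≤ x ^ 2 := by nlinarith
          nlinarith
        · have := one_sub_sq_pos (x := x) (by linarith [hx.1]) (by linarith [hx.2, m2.x2])
          nlinarith
  have der : ∀ x ∈ Set.Icc x1 x2, HasDerivAt (fun x => atn (fE a b h x) - d * fE a b h x - c * x)
      (Jac a b d h (b * c) x / (b * ((1 - x ^ 2) * (1 - fE a b h x ^ 2)))) x := by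
    intro x hxx
    obtain ⟨g1, g2, g3, g4⟩ := hx x hxx
    have df := hasDerivAt_fE (a := a) (b := b) (h := h) g1 g2
    have := (((hasDerivAt_atn g3 g4).comp x df).sub (df.const_mul d)).sub ((hasDerivAt_id x).const_mul c)
    refine this.congr_deriv ?_
    have p1 := one_sub_sq_pos g1 g2
    have p2 := one_sub_sq_pos g3 g4
    unfold Jac
    generalize fE a b h x = y at *
    field_simp
  have pos : ∀ x ∈ Set.Icc x1 x2, 0 < b * ((1 - x ^ 2) * (1 - fE a b h x ^ 2)) := by
    intro x hxx
    obtain ⟨g1, g2, g3, g4⟩ := hx x hxx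
    have p1 := one_sub_sq_pos g1 g2
    have p2 := one_sub_sq_pos g3 g4
    positivity
  have mono : MonotoneOn (fun x => atn (fE a b h x) - d * fE a b h x - c * x) (Set.Icc x1 x2) := by
    refine monotoneOn_of_hasDerivWithinAt_nonneg (convex_Icc _ _)
      (fun x hx => (der x hx).continuousAt.continuousWithinAt)
      (f' := fun x => (Jac a b d h (b * c) x / (b * ((1 - x ^ 2) * (1 - fE a b h x ^ 2))))) ?_ ?_
    · intro x hx
      exact (der x (interior_subset hx)).hasDerivWithinAt
    · intro x hx
      have hx' := hx
      rw [interior_Icc] at hx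
      exact div_nonneg (hbad x hx) (pos x (interior_subset hx')).le
  have e1 := m1.ey
  have e2 := m2.ey
  have const : ∀ x ∈ Set.Icc x1 x2, atn (fE a b h x) - d * fE a b h x - c * x = k := by
    intro x hx
    have a1 := mono (Set.left_mem_Icc.2 h12.le) hx hx.1
    have a2 := mono hx (Set.right_mem_Icc.2 h12.le) hx.2
    simp only at a1 a2
    linarith
  intro w hw
  have hwI : w ∈ Set.Icc x1 x2 := ⟨hw.1.le, hw.2.le⟩
  have ev : (fun x => atn (fE a b h x) - d * fE a b h x - c * x) =ᶠ[nhds w] fun _ => k := by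
    filter_upwards [Ioo_mem_nhds hw.1 hw.2] with x hx
    exact const x ⟨hx.1.le, hx.2.le⟩
  have := (der w hwI).unique ((hasDerivAt_const w k).congr_of_eventuallyEq ev)
  rcases div_eq_zero_iff.1 this with h | h
  · exact h
  · exact absurd h (pos w hwI).ne'

lemma ivt_sign {F : ℝ → ℝ} {s t : ℝ} (hst : s < t) (hF : ContinuousOn F (Set.Icc s t))
    (h : F s * F t < 0) : ∃ z ∈ Set.Ioo s t, F z = 0 := by
  rcases mul_neg_iff.1 h with ⟨h1, h2⟩ | ⟨h1, h2⟩
  · obtain ⟨z, hz, e⟩ := intermediate_value_Ioo' hst.le hF ⟨h2, h1⟩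
    exact ⟨z, hz, e⟩
  · obtain ⟨z, hz, e⟩ := intermediate_value_Ioo hst.le hF ⟨h1, h2⟩
    exact ⟨z, hz, e⟩

lemma five {a b c d h k : ℝ} (hb : 0 < b) (hc : 0 < c) {x0 x1 x2 x3 x4 : ℝ} (h0 : 0 < x0)
    (h01 : x0 < x1) (h12 : x1 < x2) (h23 : x2 < x3) (h34 : x3 < x4)
    (m0 : MX a b c d h k x0 (fE a b h x0)) (m1 : MX a b c d h k x1 (fE a b h x1))
    (m2 : MX a b c d h k x2 (fE a b h x2)) (m3 : MX a b c d h k x3 (fE a b h x3))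
    (m4 : MX a b c d h k x4 (fE a b h x4)) (hy : fE a b h x3 < 0) : False := by
  have hbc : 0 < b * c := mul_pos hb hc
  have X0 : ∀ x ∈ Set.Icc x0 x4, 0 < x := fun x hx => h0.trans_le hx.1
  have X1 : ∀ x ∈ Set.Icc x0 x4, x < 1 := fun x hx => hx.2.trans_lt m4.x2
  have pp : ∀ x ∈ Set.Icc x0 x4, 0 < 1 - x ^ 2 := fun x hx =>
    one_sub_sq_pos (by linarith [X0 x hx]) (X1 x hx)
  have hP : ∀ x ∈ Set.Icc x0 x4, a * (1 - x ^ 2) < 1 := by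
    intro x hx
    have h5 := m0.hP
    have h6 := pp x hx
    rcases le_total 0 a with ha | ha
    · have := hx.1
      have : x0 ^ 2 ≤ x ^ 2 := by nlinarith
      nlinarith
    · nlinarith
  have fm : ∀ s ∈ Set.Icc x0 x4, ∀ t ∈ Set.Icc x0 x4, s < t → fE a b h s < fE a b h t :=
    fun s hs t ht hst => fE_lt hb (X0 s hs).le hst (X1 t ht) (hP s hs)
  have I0 : x0 ∈ Set.Icc x0 x4 := ⟨by linarith, by linarith⟩
  have I3 : x3 ∈ Set.Icc x0 x4 := ⟨by linarith, by linarith⟩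
  have I4 : x4 ∈ Set.Icc x0 x4 := ⟨by linarith, by linarith⟩
  have f1 : ∀ x ∈ Set.Icc x0 x4, -1 < fE a b h x := by
    intro x hx
    rcases hx.1.eq_or_lt with e | e
    · rw [← e]; exact m0.y1
    · exact m0.y1.trans (fm _ I0 _ hx e)
  have f2 : ∀ x ∈ Set.Icc x0 x4, fE a b h x < 1 := by
    intro x hx
    rcases hx.2.eq_or_lt with e | e
    · rw [e]; exact m4.y2
    · exact (fm _ hx _ I4 e).trans m4.y2
  have fcont : ContinuousOn (fE a b h) (Set.Icc x0 x4) := fun x hx =>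
    (hasDerivAt_fE (by linarith [X0 x hx]) (X1 x hx)).continuousAt.continuousWithinAt
  have Jcont : ∀ β, ContinuousOn (Jac a b d h β) (Set.Icc x0 x4) := by
    intro β
    unfold Jac
    fun_prop
  have hcore : ∀ β, 0 < β → ∀ z : Fin 7 → ℝ, StrictMono z → (∀ i, z i ∈ Set.Icc x0 x4) →
      (∀ i, fE a b h (z i) < 0) → (∀ i, Jac a b d h β (z i) = 0) → False := by
    intro β hβ z hz hzI hzf hzJ
    refine core a b d h β hβ z (fun i => fE a b h (z i)) hz (fun i => X0 _ (hzI i))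
      (fun i => X1 _ (hzI i)) hzf (fun i => f1 _ (hzI i)) ?_ (fun i => hP _ (hzI i)) ?_
    · intro i
      unfold fE; field_simp; ring
    · intro i
      have := hzJ i
      unfold Jac at this
      linarith
  have noflat : ∀ s ∈ Set.Icc x0 x4, ∀ t ∈ Set.Icc x0 x4, s < t → fE a b h t ≤ 0 →
      (∀ w ∈ Set.Ioo s t, Jac a b d h (b * c) w = 0) → False := by
    intro s hs t ht hst hft hfl
    have mem : ∀ i : Fin 7, s + (t - s) * (((i : ℕ) + 1 : ℝ) / 8) ∈ Set.Ioo s t := by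
      intro i
      have h1 : (((i : ℕ) : ℝ)) ≤ 6 := by exact_mod_cast Nat.le_of_lt_succ i.2
      have h2 : (0 : ℝ) ≤ ((i : ℕ) : ℝ) := Nat.cast_nonneg _
      constructor <;> nlinarith
    have memI : ∀ i : Fin 7, s + (t - s) * (((i : ℕ) + 1 : ℝ) / 8) ∈ Set.Icc x0 x4 := fun i =>
      ⟨hs.1.trans (mem i).1.le, (mem i).2.le.trans ht.2⟩
    refine hcore (b * c) hbc (fun i => s + (t - s) * (((i : ℕ) + 1 : ℝ) / 8)) ?_ memI ?_ ?_
    · intro i j hij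
      have : (((i : ℕ) : ℝ)) < ((j : ℕ) : ℝ) := by exact_mod_cast hij
      simp only
      have : 0 < t - s := by linarith
      gcongr
    · intro i
      exact (fm _ (memI i) _ ht (mem i).2).trans_le hft
    · intro i
      exact hfl _ (mem i)
  have bad : ∀ s ∈ Set.Icc x0 x4, ∀ t ∈ Set.Icc x0 x4, s < t → fE a b h t ≤ 0 →
      MX a b c d h k s (fE a b h s) → MX a b c d h k t (fE a b h t) →
      ∃ w ∈ Set.Ioo s t, Jac a b d h (b * c) w < 0 := by
    intro s hs t ht hst hft ms mt
    rcases bad_or hb (X0 s hs) hst ms mt with h | h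
    · exact h
    · exact (noflat s hs t ht hst hft h).elim
  have I1 : x1 ∈ Set.Icc x0 x4 := ⟨by linarith, by linarith⟩
  have I2 : x2 ∈ Set.Icc x0 x4 := ⟨by linarith, by linarith⟩
  obtain ⟨w0, hw0, j0⟩ := bad x0 I0 x1 I1 h01 ((fm _ I1 _ I3 (by linarith)).trans hy).le m0 m1
  obtain ⟨w1, hw1, j1⟩ := bad x1 I1 x2 I2 h12 ((fm _ I2 _ I3 (by linarith)).trans hy).le m1 m2
  obtain ⟨w2, hw2, j2⟩ := bad x2 I2 x3 I3 h23 hy.le m2 m3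
  obtain ⟨w3, hw3, j3, hf3⟩ : ∃ w ∈ Set.Ioo x3 x4, Jac a b d h (b * c) w < 0 ∧ fE a b h w ≤ 0 := by
    rcases le_or_gt (fE a b h x4) 0 with hy4 | hy4
    · obtain ⟨w, hw, j⟩ := bad x3 I3 x4 I4 h34 hy4 m3 m4
      exact ⟨w, hw, j, ((fm _ ⟨by linarith [hw.1], hw.2.le⟩ _ I4 hw.2).trans_le hy4).le⟩
    · obtain ⟨xb, hxb, fb⟩ := ivt_sign h34 (fcont.mono (Set.Icc_subset_Icc (by linarith) le_rfl))
        (mul_neg_of_neg_of_pos hy hy4)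
      have Ib : xb ∈ Set.Icc x0 x4 := ⟨by linarith [hxb.1], hxb.2.le⟩
      rcases bad_or hb (X0 x3 I3) h34 m3 m4 with ⟨w, hw, j⟩ | hfl
      · have Iw : w ∈ Set.Icc x0 x4 := ⟨by linarith [hw.1], hw.2.le⟩
        rcases le_or_gt (fE a b h w) 0 with hfw | hfw
        · exact ⟨w, hw, j, hfw⟩
        · refine ⟨xb, hxb, ?_, fb.le⟩
          have hlt : xb < w := by
            by_contra hcon
            rcases (not_lt.1 hcon).eq_or_lt with e | e
            · rw [e] at hfw; linarith
            · have := fm _ Iw _ Ib e; linarith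
          have xb0 := X0 _ Ib
          have pb0 := pp _ Ib
          have pw0 := pp _ Iw
          have hle : 1 - w ^ 2 ≤ 1 - xb ^ 2 := by nlinarith
          have q0 := one_sub_sq_pos (f1 _ Iw) (f2 _ Iw)
          have q1 : 1 - fE a b h w ^ 2 ≤ 1 := by nlinarith
          have hPb := hP _ Ib
          have hPw := hP _ Iw
          unfold Jac at j ⊢
          rw [fb]
          generalize fE a b h w = y at *
          generalize 1 - w ^ 2 = p at *
          generalize 1 - xb ^ 2 = pb at *
          generalize 1 - y ^ 2 = q at *
          norm_num
          rcases le_or_gt 1 d with hd | hd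
          · have : 0 < b * c * pb := by positivity
            nlinarith
          · have u1 : (1 - a * pb) * p ≤ (1 - a * p) * pb := by nlinarith
            have u2 : (1 - d) * q ≤ 1 - d * q := by nlinarith
            have u3 := mul_le_mul u1 u2 (mul_nonneg (by linarith) q0.le)
              (mul_nonneg (by linarith) pb0.le)
            have u4 : (p * q) * ((1 - a * pb) * (1 - d)) < (p * q) * (b * c * pb) := by nlinarith
            exact lt_of_mul_lt_mul_left u4 (by positivity)
      · exact (noflat x3 I3 xb Ib hxb.1 fb.le
          (fun w hw => hfl w ⟨hw.1, hw.2.trans hxb.2⟩)).elim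
  have W0 : w0 ∈ Set.Icc x0 x4 := ⟨by linarith [hw0.1], by linarith [hw0.2]⟩
  have W1 : w1 ∈ Set.Icc x0 x4 := ⟨by linarith [hw1.1], by linarith [hw1.2]⟩
  have W2 : w2 ∈ Set.Icc x0 x4 := ⟨by linarith [hw2.1], by linarith [hw2.2]⟩
  have W3 : w3 ∈ Set.Icc x0 x4 := ⟨by linarith [hw3.1], by linarith [hw3.2]⟩
  obtain ⟨ε, e0, eb, ew0, ew1, ew2, ew3⟩ : ∃ ε > 0, ε < b * c ∧ ε < -Jac a b d h (b * c) w0 ∧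
      ε < -Jac a b d h (b * c) w1 ∧ ε < -Jac a b d h (b * c) w2 ∧ ε < -Jac a b d h (b * c) w3 := by
    have : 0 < min (b * c) (min (min (-Jac a b d h (b * c) w0) (-Jac a b d h (b * c) w1))
        (min (-Jac a b d h (b * c) w2) (-Jac a b d h (b * c) w3))) := by
      simp only [lt_min_iff, neg_pos]; tauto
    obtain ⟨ε, h1, h2⟩ := exists_between this
    simp only [lt_min_iff] at h2
    exact ⟨ε, h1, by tauto⟩
  have negJ : ∀ w ∈ Set.Icc x0 x4, ε < -Jac a b d h (b * c) w → Jac a b d h (b * c - ε) w < 0 := by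
    intro w hw he
    have p0 := pp _ hw
    have q0 := one_sub_sq_pos (f1 _ hw) (f2 _ hw)
    have : (1 - w ^ 2) * (1 - fE a b h w ^ 2) ≤ 1 := by
      apply mul_le_one₀ _ q0.le _ <;> nlinarith
    unfold Jac at he ⊢
    nlinarith
  have posJ : ∀ w ∈ Set.Icc x0 x4, MX a b c d h k w (fE a b h w) → 0 < Jac a b d h (b * c - ε) w := by
    intro w hw m
    have p0 := pp _ hw
    have q0 := one_sub_sq_pos (f1 _ hw) (f2 _ hw)
    have := mul_pos e0 (mul_pos p0 q0)
    have := m.hJ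
    unfold Jac
    linarith
  have zer : ∀ s ∈ Set.Icc x0 x4, ∀ t ∈ Set.Icc x0 x4, s < t →
      Jac a b d h (b * c - ε) s * Jac a b d h (b * c - ε) t < 0 →
      ∃ z ∈ Set.Ioo s t, Jac a b d h (b * c - ε) z = 0 := fun s hs t ht hst hh =>
    ivt_sign hst ((Jcont _).mono (Set.Icc_subset_Icc hs.1 ht.2)) hh
  have P0 := posJ _ I0 m0
  have P1 := posJ _ I1 m1
  have P2 := posJ _ I2 m2
  have P3 := posJ _ I3 m3
  have N0 := negJ _ W0 ew0
  have N1 := negJ _ W1 ew1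
  have N2 := negJ _ W2 ew2
  have N3 := negJ _ W3 ew3
  obtain ⟨z0, hz0, k0⟩ := zer x0 I0 w0 W0 hw0.1 (mul_neg_of_pos_of_neg P0 N0)
  obtain ⟨z1, hz1, k1⟩ := zer w0 W0 x1 I1 hw0.2 (mul_neg_of_neg_of_pos N0 P1)
  obtain ⟨z2, hz2, k2⟩ := zer x1 I1 w1 W1 hw1.1 (mul_neg_of_pos_of_neg P1 N1)
  obtain ⟨z3, hz3, k3⟩ := zer w1 W1 x2 I2 hw1.2 (mul_neg_of_neg_of_pos N1 P2)
  obtain ⟨z4, hz4, k4⟩ := zer x2 I2 w2 W2 hw2.1 (mul_neg_of_pos_of_neg P2 N2)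
  obtain ⟨z5, hz5, k5⟩ := zer w2 W2 x3 I3 hw2.2 (mul_neg_of_neg_of_pos N2 P3)
  obtain ⟨z6, hz6, k6⟩ := zer x3 I3 w3 W3 hw3.1 (mul_neg_of_pos_of_neg P3 N3)
  have o1 : z0 < z1 := hz0.2.trans hz1.1
  have o2 : z1 < z2 := hz1.2.trans hz2.1
  have o3 : z2 < z3 := hz2.2.trans hz3.1
  have o4 : z3 < z4 := hz3.2.trans hz4.1
  have o5 : z4 < z5 := hz4.2.trans hz5.1
  have o6 : z5 < z6 := hz5.2.trans hz6.1
  have lo := hz0.1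
  have up := hz6.2
  have hw34 := hw3.2
  have hmem : ∀ i : Fin 7, x0 < (![z0, z1, z2, z3, z4, z5, z6] : Fin 7 → ℝ) i ∧
      (![z0, z1, z2, z3, z4, z5, z6] : Fin 7 → ℝ) i < w3 := by
    intro i
    fin_cases i <;> simp <;> constructor <;> linarith
  refine hcore (b * c - ε) (by linarith) ![z0, z1, z2, z3, z4, z5, z6] ?_ ?_ ?_ ?_
  · rw [Fin.strictMono_iff_lt_succ]
    intro i
    fin_cases i <;> simp <;> assumption
  · intro i
    exact ⟨(hmem i).1.le, by linarith [(hmem i).2]⟩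
  · intro i
    exact (fm _ ⟨(hmem i).1.le, by linarith [(hmem i).2]⟩ _ W3 (hmem i).2).trans_le hf3
  · intro i
    fin_cases i <;> simpa

lemma chain_card {a b c d h k : ℝ} (hb : 0 < b) (hc : 0 < c) :
    {z : ℝ × ℝ | MX a b c d h k z.1 z.2 ∧ 0 ≤ z.1 ∧ (z.2 < 0 → 0 < z.1)}.encard ≤ 4 := by
  by_contra hcon
  rw [not_le] at hcon
  have h5 : (5 : ℕ∞) ≤ {z : ℝ × ℝ | MX a b c d h k z.1 z.2 ∧ 0 ≤ z.1 ∧ (z.2 < 0 → 0 < z.1)}.encard := by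
    have := Order.add_one_le_of_lt hcon
    norm_num at this
    exact this
  obtain ⟨t, ht, htc⟩ := Set.exists_subset_encard_eq h5
  have inj : Set.InjOn Prod.fst t := by
    rintro ⟨x, y⟩ h1 ⟨x', y'⟩ h2 e
    simp only at e
    subst e
    have e : y = y' := MX.y_eq hb (ht h1).1 (ht h2).1
    rw [e]
  have hfin : t.Finite := Set.finite_of_encard_eq_coe (k := 5) htc
  have hc2 : (Prod.fst '' t).encard = 5 := by rw [inj.encard_image, htc]
  have hfin2 : (Prod.fst '' t).Finite := hfin.image _
  have hcard : hfin2.toFinset.card = 5 := by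
    have := hfin2.encard_eq_coe_toFinset_card
    rw [hc2] at this
    exact_mod_cast this.symm
  let X := hfin2.toFinset.orderEmbOfFin hcard
  have hX : ∀ i, MX a b c d h k (X i) (fE a b h (X i)) ∧ 0 ≤ X i ∧ (fE a b h (X i) < 0 → 0 < X i) := by
    intro i
    have := hfin2.toFinset.orderEmbOfFin_mem hcard i
    rw [Set.Finite.mem_toFinset] at this
    obtain ⟨z, hz, e⟩ := this
    have e' : X i = z.1 := e.symm
    rw [e']
    have := ht hz
    rw [MX.fE_eq hb this.1]
    exact this
  have hlt : ∀ i j, i < j → X i < X j := fun i j hij => X.strictMono hij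
  have y3 : fE a b h (X 3) < 0 := by
    by_contra hh
    exact RR_lt hb (hX 3).1 (hX 4).1 (hX 3).2.1 (not_lt.1 hh) (hlt 3 4 (by decide))
  have y0 : fE a b h (X 0) < 0 :=
    ((hX 0).1.lt hb (hX 3).1 (hX 0).2.1 (hlt 0 3 (by decide))).trans y3
  exact five hb hc ((hX 0).2.2 y0) (hlt 0 1 (by decide)) (hlt 1 2 (by decide)) (hlt 2 3 (by decide))
    (hlt 3 4 (by decide)) (hX 0).1 (hX 1).1 (hX 2).1 (hX 3).1 (hX 4).1 y3

lemma LL_card {a b c d h k : ℝ} (hb : 0 < b) :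
    {z : ℝ × ℝ | MX a b c d h k z.1 z.2 ∧ z.1 ≤ 0 ∧ z.2 ≤ 0}.encard ≤ 1 := by
  rw [Set.encard_le_one_iff]
  rintro ⟨x, y⟩ ⟨x', y'⟩ ⟨m, h1, h2⟩ ⟨m', h1', h2'⟩
  exact Prod.ext_iff.2 (LL_unique hb m m' h1 h2 h1' h2')

lemma RR_card {a b c d h k : ℝ} (hb : 0 < b) :
    {z : ℝ × ℝ | MX a b c d h k z.1 z.2 ∧ 0 ≤ z.1 ∧ 0 ≤ z.2}.encard ≤ 1 := by
  rw [Set.encard_le_one_iff]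
  rintro ⟨x, y⟩ ⟨x', y'⟩ ⟨m, h1, h2⟩ ⟨m', h1', h2'⟩
  exact Prod.ext_iff.2 (RR_unique hb m m' h1 h2 h1' h2')

lemma half_card {a b c d h k : ℝ} (hb : 0 < b) (hc : 0 < c)
    (hno : ∀ x y, MX a b c d h k x y → x < 0 → 0 < y → False) :
    {z : ℝ × ℝ | MX a b c d h k z.1 z.2}.encard ≤ 5 := by
  have sub : {z : ℝ × ℝ | MX a b c d h k z.1 z.2} ⊆
      {z : ℝ × ℝ | MX a b c d h k z.1 z.2 ∧ 0 ≤ z.1 ∧ (z.2 < 0 → 0 < z.1)} ∪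
      {z : ℝ × ℝ | MX a b c d h k z.1 z.2 ∧ z.1 ≤ 0 ∧ z.2 ≤ 0} := by
    rintro ⟨x, y⟩ m
    simp only [Set.mem_setOf_eq, Set.mem_union] at m ⊢
    have := hno x y m
    rcases lt_trichotomy x 0 with hx | hx | hx
    · right
      exact ⟨m, hx.le, not_lt.1 (this hx)⟩
    · rcases le_or_gt y 0 with hy | hy
      · right; exact ⟨m, hx.le, hy⟩
      · left; exact ⟨m, hx.ge, fun h => absurd h (not_lt.2 hy.le)⟩
    · left; exact ⟨m, hx.le, fun _ => hx⟩
  calc _ ≤ _ := Set.encard_le_encard sub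
    _ ≤ _ := Set.encard_union_le _ _
    _ ≤ 4 + 1 := add_le_add (chain_card hb hc) (LL_card hb)
    _ = 5 := by norm_num

lemma total_card {a b c d h k : ℝ} (hb : 0 < b) (hc : 0 < c) :
    {z : ℝ × ℝ | MX a b c d h k z.1 z.2}.encard ≤ 5 := by
  by_cases h1 : ∀ x y, MX a b c d h k x y → x < 0 → 0 < y → False
  · exact half_card hb hc h1
  by_cases h2 : ∀ x y, MX a b c d h k x y → 0 < x → y < 0 → False
  · have := half_card (a := a) (d := d) (h := -h) (k := -k) hb hc (fun x y m hx hy => by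
      have m' := m.neg
      rw [neg_neg, neg_neg] at m'
      exact h2 _ _ m' (by linarith) (by linarith))
    refine le_trans ?_ this
    rw [← (neg_injective (G := ℝ × ℝ)).encard_image]
    apply Set.encard_le_encard
    rintro _ ⟨z, m, rfl⟩
    exact MX.neg m
  push Not at h1 h2
  obtain ⟨x', y', m', hx', hy', -⟩ := h1
  obtain ⟨x, y, m, hx, hy, -⟩ := h2
  obtain ⟨ha, hd, hdet⟩ := both hb hc m m' hx hy hx' hy'
  have c3 : {z : ℝ × ℝ | MX a b c d h k z.1 z.2 ∧ 0 < z.1 ∧ z.2 < 0}.encard ≤ 1 := by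
    rw [Set.encard_le_one_iff]
    rintro ⟨x, y⟩ ⟨x', y'⟩ ⟨m, h1, h2⟩ ⟨m', h1', h2'⟩
    exact Prod.ext_iff.2 (RL_unique hb hc hdet m m' h1 h2 h1' h2')
  have c4 : {z : ℝ × ℝ | MX a b c d h k z.1 z.2 ∧ z.1 < 0 ∧ 0 < z.2}.encard ≤ 1 := by
    rw [Set.encard_le_one_iff]
    rintro ⟨x, y⟩ ⟨x', y'⟩ ⟨m, h1, h2⟩ ⟨m', h1', h2'⟩
    exact Prod.ext_iff.2 (LR_unique hb hc hdet m m' h1 h2 h1' h2')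
  have sub : {z : ℝ × ℝ | MX a b c d h k z.1 z.2} ⊆
      ({z : ℝ × ℝ | MX a b c d h k z.1 z.2 ∧ 0 ≤ z.1 ∧ 0 ≤ z.2} ∪
      {z : ℝ × ℝ | MX a b c d h k z.1 z.2 ∧ z.1 ≤ 0 ∧ z.2 ≤ 0}) ∪
      ({z : ℝ × ℝ | MX a b c d h k z.1 z.2 ∧ 0 < z.1 ∧ z.2 < 0} ∪
      {z : ℝ × ℝ | MX a b c d h k z.1 z.2 ∧ z.1 < 0 ∧ 0 < z.2}) := by
    rintro ⟨x, y⟩ m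
    rcases le_or_gt 0 x with hx | hx <;> rcases le_or_gt 0 y with hy | hy
    · exact Or.inl (Or.inl ⟨m, hx, hy⟩)
    · rcases hx.eq_or_lt with e | hx
      · exact Or.inl (Or.inr ⟨m, e.ge, hy.le⟩)
      · exact Or.inr (Or.inl ⟨m, hx, hy⟩)
    · rcases hy.eq_or_lt with e | hy
      · exact Or.inl (Or.inr ⟨m, hx.le, e.ge⟩)
      · exact Or.inr (Or.inr ⟨m, hx, hy⟩)
    · exact Or.inl (Or.inr ⟨m, hx.le, hy.le⟩)
  calc _ ≤ _ := Set.encard_le_encard sub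
    _ ≤ _ := Set.encard_union_le _ _
    _ ≤ _ := add_le_add (Set.encard_union_le _ _) (Set.encard_union_le _ _)
    _ ≤ (1 + 1) + (1 + 1) := add_le_add (add_le_add (RR_card hb) (LL_card hb)) (add_le_add c3 c4)
    _ ≤ 5 := by norm_num

lemma hasDerivAt_binEnt {x : ℝ} (h1 : -1 < x) (h2 : x < 1) : HasDerivAt binEnt (-atn x) x := by
  have e1 : HasDerivAt (fun x : ℝ => (1 + x) / 2) (1 / 2) x := ((hasDerivAt_id x).const_add 1).div_const 2
  have e2 : HasDerivAt (fun x : ℝ => (1 - x) / 2) (-1 / 2) x := ((hasDerivAt_id x).const_sub 1).div_const 2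
  have a1 : 0 < 1 + x := by linarith
  have a2 : 0 < 1 - x := by linarith
  have := ((e1.mul (e1.log (by positivity))).neg).sub (e2.mul (e2.log (by positivity)))
  refine this.congr_deriv ?_
  unfold atn
  rw [Real.log_div a1.ne' two_ne_zero, Real.log_div a2.ne' two_ne_zero]
  field_simp
  ring

lemma second_order {φ φ1 : ℝ → ℝ} {c : ℝ} (hm : IsLocalMax φ 0)
    (h1 : ∀ᶠ t in nhds (0 : ℝ), HasDerivAt φ (φ1 t) t) (h2 : HasDerivAt φ1 c 0) :
    φ1 0 = 0 ∧ c ≤ 0 := by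
  have z : φ1 0 = 0 := hm.hasDerivAt_eq_zero h1.self_of_nhds
  refine ⟨z, ?_⟩
  by_contra hc
  rw [not_le] at hc
  have ed : deriv φ =ᶠ[nhds 0] φ1 := h1.mono fun t ht => ht.deriv
  have d2 : deriv (deriv φ) 0 = c := by rw [ed.deriv_eq, h2.deriv]
  have hmin := isLocalMin_of_deriv_deriv_pos (f := φ) (x₀ := 0) (by rw [d2]; exact hc)
    (by rw [ed.self_of_nhds, z]) h1.self_of_nhds.continuousAt
  have hconst : φ =ᶠ[nhds 0] fun _ => φ 0 := by
    filter_upwards [hm, hmin] with t a b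
    exact le_antisymm a b
  have : deriv φ =ᶠ[nhds 0] fun _ => 0 := by
    have := hconst.deriv
    simpa using this
  have : deriv (deriv φ) 0 = 0 := by rw [this.deriv_eq]; simp
  linarith

lemma localMax_dir {α J11 J22 J12 h1 h2 x y : ℝ} (x1 : -1 < x) (x2 : x < 1) (y1 : -1 < y) (y2 : y < 1)
    (hm : IsLocalMax (twoPopPressure α J11 J22 J12 h1 h2) (x, y)) (u v : ℝ) :
    α * u * (J11 * α * x + J12 * (1 - α) * y + h1 - atn x) +
      (1 - α) * v * (J12 * α * x + J22 * (1 - α) * y + h2 - atn y) = 0 ∧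
    α * (J11 * α - 1 / (1 - x ^ 2)) * u ^ 2 + 2 * J12 * α * (1 - α) * (u * v) +
      (1 - α) * (J22 * (1 - α) - 1 / (1 - y ^ 2)) * v ^ 2 ≤ 0 := by
  have cont : Continuous (fun t : ℝ => ((x + u * t, y + v * t) : ℝ × ℝ)) := by fun_prop
  have hm' : IsLocalMax (fun t : ℝ => twoPopPressure α J11 J22 J12 h1 h2 (x + u * t, y + v * t)) 0 := by
    have : Filter.Tendsto (fun t : ℝ => ((x + u * t, y + v * t) : ℝ × ℝ)) (nhds 0) (nhds (x, y)) := by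
      have := cont.tendsto 0
      simpa using this
    have := this.eventually hm
    unfold IsLocalMax IsMaxFilter
    filter_upwards [this] with t ht
    simpa using ht
  have dX : ∀ t : ℝ, HasDerivAt (fun t : ℝ => x + u * t) u t := fun t => by
    simpa using ((hasDerivAt_id t).const_mul u).const_add x
  have dY : ∀ t : ℝ, HasDerivAt (fun t : ℝ => y + v * t) v t := fun t => by
    simpa using ((hasDerivAt_id t).const_mul v).const_add y
  have evx : ∀ᶠ t in nhds (0 : ℝ), x + u * t ∈ Set.Ioo (-1 : ℝ) 1 := by
    apply (dX 0).continuousAt.eventually_mem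
    apply Ioo_mem_nhds <;> simp <;> assumption
  have evy : ∀ᶠ t in nhds (0 : ℝ), y + v * t ∈ Set.Ioo (-1 : ℝ) 1 := by
    apply (dY 0).continuousAt.eventually_mem
    apply Ioo_mem_nhds <;> simp <;> assumption
  have key := second_order
    (φ1 := fun t => α * u * (J11 * α * (x + u * t) + J12 * (1 - α) * (y + v * t) + h1 - atn (x + u * t)) +
      (1 - α) * v * (J12 * α * (x + u * t) + J22 * (1 - α) * (y + v * t) + h2 - atn (y + v * t)))
    (c := α * u * (J11 * α * u + J12 * (1 - α) * v - (1 / (1 - x ^ 2)) * u) +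
      (1 - α) * v * (J12 * α * u + J22 * (1 - α) * v - (1 / (1 - y ^ 2)) * v)) hm' ?_ ?_
  · obtain ⟨k1, k2⟩ := key
    constructor
    · simpa using k1
    · linarith
  · filter_upwards [evx, evy] with t htx hty
    have bx : HasDerivAt (fun t => binEnt (x + u * t)) (-atn (x + u * t) * u) t := by
      have e : HasDerivAt binEnt (-atn (x + u * t)) (x + u * t) := hasDerivAt_binEnt htx.1 htx.2
      exact e.comp t (dX t)
    have byy : HasDerivAt (fun t => binEnt (y + v * t)) (-atn (y + v * t) * v) t := by
      have e : HasDerivAt binEnt (-atn (y + v * t)) (y + v * t) := hasDerivAt_binEnt hty.1 hty.2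
      exact e.comp t (dY t)
    have := ((((((((dX t).pow 2).const_mul (1 / 2 * J11 * α ^ 2)).add
      (((dX t).const_mul (J12 * α * (1 - α))).mul (dY t))).add
      (((dY t).pow 2).const_mul (1 / 2 * J22 * (1 - α) ^ 2))).add ((dX t).const_mul (α * h1))).add
      ((dY t).const_mul ((1 - α) * h2))).add (bx.const_mul α)).add (byy.const_mul (1 - α))
    refine this.congr_deriv ?_
    simp
    ring
  · have ax : HasDerivAt (fun t => atn (x + u * t)) (1 / (1 - x ^ 2) * u) 0 := by
      have e : HasDerivAt atn (1 / (1 - x ^ 2)) (x + u * 0) := by simpa using hasDerivAt_atn x1 x2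
      exact e.comp (0 : ℝ) (dX 0)
    have ay : HasDerivAt (fun t => atn (y + v * t)) (1 / (1 - y ^ 2) * v) 0 := by
      have e : HasDerivAt atn (1 / (1 - y ^ 2)) (y + v * 0) := by simpa using hasDerivAt_atn y1 y2
      exact e.comp (0 : ℝ) (dY 0)
    have := ((((((dX 0).const_mul (J11 * α)).add ((dY 0).const_mul (J12 * (1 - α)))).add_const h1).sub ax).const_mul
      (α * u)).add (((((dX 0).const_mul (J12 * α)).add
        ((dY 0).const_mul (J22 * (1 - α)))).add_const h2).sub ay |>.const_mul ((1 - α) * v))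
    exact this

lemma localMax_MX {α J11 J22 J12 h1 h2 x y : ℝ} (a0 : 0 < α) (a1 : α < 1) (hJ : J12 ≠ 0)
    (x1 : -1 < x) (x2 : x < 1) (y1 : -1 < y) (y2 : y < 1)
    (hm : IsLocalMax (twoPopPressure α J11 J22 J12 h1 h2) (x, y)) :
    MX (J11 * α) (J12 * (1 - α)) (J12 * α) (J22 * (1 - α)) h1 h2 x y := by
  have dir := localMax_dir x1 x2 y1 y2 hm
  have a1' : 0 < 1 - α := by linarith
  have p0 := one_sub_sq_pos x1 x2
  have q0 := one_sub_sq_pos y1 y2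
  have e1 := (dir 1 0).1
  have e2 := (dir 0 1).1
  simp at e1 e2
  have e1' := e1.resolve_left a0.ne'
  have e2' := e2.resolve_left a1'.ne'
  set P := 1 / (1 - x ^ 2) - J11 * α with hP
  set Q := 1 / (1 - y ^ 2) - J22 * (1 - α) with hQ
  have quad : ∀ u v : ℝ, 2 * J12 * α * (1 - α) * (u * v) ≤ α * P * u ^ 2 + (1 - α) * Q * v ^ 2 := by
    intro u v
    have := (dir u v).2
    rw [hP, hQ]; linarith
  have P0 : 0 ≤ P := by
    have := quad 1 0
    simp at this
    exact nonneg_of_mul_nonneg_right this a0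
  have Q0 : 0 ≤ Q := by
    have := quad 0 1
    simp at this
    exact nonneg_of_mul_nonneg_right this a1'
  have J2 : 0 < J12 ^ 2 := by positivity
  have PQ : J12 ^ 2 * (α * (1 - α)) ≤ P * Q := by
    rcases Q0.eq_or_lt with q | q
    · exfalso
      have := quad (J12 * (1 - α)) ((α * P * (J12 * (1 - α)) ^ 2 + 1) / (2 * J12 ^ 2 * α * (1 - α) ^ 2))
      rw [← q] at this
      have e : 2 * J12 * α * (1 - α) * (J12 * (1 - α) *
        ((α * P * (J12 * (1 - α)) ^ 2 + 1) / (2 * J12 ^ 2 * α * (1 - α) ^ 2))) =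
          α * P * (J12 * (1 - α)) ^ 2 + 1 := by
        field_simp
      rw [e] at this
      linarith
    · have := quad Q (J12 * α)
      have h3 : 0 ≤ α * Q * (P * Q - J12 ^ 2 * (α * (1 - α))) := by nlinarith
      have := nonneg_of_mul_nonneg_right h3 (by positivity)
      linarith
  have PQ0 : 0 < P * Q := lt_of_lt_of_le (by positivity) PQ
  have P1 : 0 < P := by
    rcases P0.eq_or_lt with q | q
    · rw [← q] at PQ0; simp at PQ0
    · exact q
  have Q1 : 0 < Q := by
    rcases Q0.eq_or_lt with q | q
    · rw [← q] at PQ0; simp at PQ0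
    · exact q
  have eP : P * (1 - x ^ 2) = 1 - J11 * α * (1 - x ^ 2) := by rw [hP]; field_simp
  have eQ : Q * (1 - y ^ 2) = 1 - J22 * (1 - α) * (1 - y ^ 2) := by rw [hQ]; field_simp
  have m1 := mul_pos P1 p0
  have m2 := mul_pos Q1 q0
  refine ⟨x1, x2, y1, y2, by linarith, by linarith, by linarith, by linarith, ?_⟩
  rw [← eP, ← eQ]
  have := mul_le_mul_of_nonneg_right PQ (mul_pos p0 q0).le
  linarith

/-- At most five equilibrium states for the two-population model: for `α ∈ (0,1)`,
`J12 ≠ 0` and arbitrary `J11, J22, h1, h2`, the set of local maxima of the pressure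
functional inside the open square `(−1,1)²` is finite with at most `5` elements. -/
theorem twoPopulation_at_most_five_maxima (α J11 J22 J12 h1 h2 : ℝ)
    (hα : α ∈ Set.Ioo (0 : ℝ) 1) (hJ12 : J12 ≠ 0) :
    {x : ℝ × ℝ | x ∈ Set.Ioo (-1 : ℝ) 1 ×ˢ Set.Ioo (-1 : ℝ) 1 ∧
        IsLocalMax (twoPopPressure α J11 J22 J12 h1 h2) x}.Finite ∧
      {x : ℝ × ℝ | x ∈ Set.Ioo (-1 : ℝ) 1 ×ˢ Set.Ioo (-1 : ℝ) 1 ∧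
        IsLocalMax (twoPopPressure α J11 J22 J12 h1 h2) x}.ncard ≤ 5 := by
  rw [← Set.encard_le_coe_iff_finite_ncard_le]
  have a1' : 0 < 1 - α := by linarith [hα.2]
  have a0 := hα.1
  rcases lt_or_gt_of_ne hJ12 with hneg | hpos
  · have b0 : 0 < -(J12 * (1 - α)) := by nlinarith
    have c0 : 0 < -(J12 * α) := by nlinarith
    refine le_trans ?_ (total_card (a := J11 * α) (d := J22 * (1 - α)) (h := h1) (k := -h2) b0 c0)
    have inj : Function.Injective (fun z : ℝ × ℝ => (z.1, -z.2)) := by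
      rintro ⟨x, y⟩ ⟨x', y'⟩ e
      simpa using e
    rw [← inj.encard_image]
    apply Set.encard_le_encard
    rintro _ ⟨⟨x, y⟩, ⟨⟨hx, hy⟩, hm⟩, rfl⟩
    exact (localMax_MX a0 hα.2 hJ12 hx.1 hx.2 hy.1 hy.2 hm).flip
  · refine le_trans ?_ (total_card (a := J11 * α) (b := J12 * (1 - α)) (c := J12 * α)
      (d := J22 * (1 - α)) (h := h1) (k := h2) (by positivity) (by positivity))
    apply Set.encard_le_encard
    rintro ⟨x, y⟩ ⟨⟨hx, hy⟩, hm⟩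
    exact localMax_MX a0 hα.2 hJ12 hx.1 hx.2 hy.1 hy.2 hm
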